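/- Let d, s ∈ ℕ with s ≥ 1, let M be an integer, and let σ ∈ ℝ^d be a fixed shift. Let x₁,…,x_s, y₁,…,y_s ∈ ℝ^d be 2s pairwise distinct points such that for each k, x_k and y_k are not separated at level M under σ. For each k, let L_k be the least integer ℓ ≤ M such that x_k and y_k are not separated at level ℓ (such ℓ exists by assumption; note that non-separation at level ℓ implies non-separation at every level ℓ' ≥ ℓ). Assume that for every k and every j ≠ k, the points x_j and x_k are separated at level L_k. Let μ be the uniform distribution on {x₁,…,x_s} and ν the uniform distribution on {y₁,…,y_s}. Then the unique coupling of (μ, ν) minimizing the cost Σ_{x,y} τ(x,y)·T_σ(x,y) over couplings τ is the perfect matching f given by f(x_k, y_k) = 1/s for every k and f = 0 elsewhere. Consequently, for any ground cost c, the Flowtree estimate of the distance between μ and ν equals (1/s)·Σ_{k=1}^s c(x_k, y_k). -/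

import Mathlib

open MeasureTheory
open scoped Classical

/-- `x` and `y` are separated at level `ℓ` under the shift `σ`: some coordinate of their
grid cells of side `2^ℓ` (after shifting by `σ`) differs. -/
def Separated (d : ℕ) (σ : Fin d → ℝ) (ℓ : ℤ) (x y : Fin d → ℝ) : Prop :=
  ∃ i, ⌊(x i + σ i) / (2 : ℝ) ^ ℓ⌋ ≠ ⌊(y i + σ i) / (2 : ℝ) ^ ℓ⌋

/-- The quadtree distance `T_σ(x,y) = 2 ⬝ Σ_{ℓ ≤ M} 2^ℓ ⬝ 1[x, y separated at level ℓ]`. -/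
noncomputable def quadDist (d : ℕ) (M : ℤ) (σ x y : Fin d → ℝ) : ℝ :=
  2 * ∑' ℓ : ℤ, if ℓ ≤ M ∧ Separated d σ ℓ x y then (2 : ℝ) ^ ℓ else 0

/-- `μ` is a probability distribution supported on the finite set `X`. -/
def IsDistOn {α : Type*} (X : Finset α) (μ : α → ℝ) : Prop :=
  (∀ a, 0 ≤ μ a) ∧ (∀ a, μ a ≠ 0 → a ∈ X) ∧ ∑ a ∈ X, μ a = 1

/-- `τ` is a coupling of the distributions `μ` and `ν`, supported on `X × X`. -/
def IsCouplingOn {α : Type*} (X : Finset α) (μ ν : α → ℝ) (τ : α → α → ℝ) : Prop :=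
  (∀ a b, 0 ≤ τ a b) ∧ (∀ a b, τ a b ≠ 0 → a ∈ X ∧ b ∈ X) ∧
    (∀ a, ∑ b ∈ X, τ a b = μ a) ∧ (∀ b, ∑ a ∈ X, τ a b = ν b)

/-- The optimal transport cost `W_c(μ,ν)` for distributions on the finite set `X`:
the minimum of `Σ_{x,y} τ(x,y)·c(x,y)` over all couplings `τ` of `(μ,ν)`
(expressed as an infimum; it is attained by compactness). -/
noncomputable def WOn {α : Type*} (X : Finset α) (c : α → α → ℝ) (μ ν : α → ℝ) : ℝ :=
  sInf {v | ∃ τ, IsCouplingOn X μ ν τ ∧ v = ∑ a ∈ X, ∑ b ∈ X, τ a b * c a b}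

section Separation

variable {d : ℕ} {σ : Fin d → ℝ} {x y z : Fin d → ℝ}

theorem not_separated_iff {ℓ : ℤ} : ¬ Separated d σ ℓ x y ↔
    ∀ i, ⌊(x i + σ i) / (2 : ℝ) ^ ℓ⌋ = ⌊(y i + σ i) / (2 : ℝ) ^ ℓ⌋ := by
  simp [Separated]

theorem Separated.symm {ℓ : ℤ} (h : Separated d σ ℓ x y) : Separated d σ ℓ y x :=
  h.imp fun _ hi => hi.symm

theorem Separated.trans_not_separated {ℓ : ℤ} (h : Separated d σ ℓ x y)
    (hyz : ¬ Separated d σ ℓ y z) : Separated d σ ℓ x z := by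
  obtain ⟨i, hi⟩ := h
  exact ⟨i, fun hxz => hi (hxz.trans (not_separated_iff.1 hyz i).symm)⟩

theorem Separated.mono {ℓ m : ℤ} (hℓm : ℓ ≤ m) (h : Separated d σ m x y) :
    Separated d σ ℓ x y := by
  obtain ⟨n, rfl⟩ := Int.exists_add_of_le hℓm
  have floor_eq (t : ℝ) : ⌊t / (2 : ℝ) ^ (ℓ + n)⌋ = ⌊t / (2 : ℝ) ^ ℓ⌋ / ((2 ^ n : ℕ) : ℤ) := by
    rw [← Int.floor_div_natCast, zpow_add₀ two_ne_zero, ← div_div]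
    norm_cast
  obtain ⟨i, hi⟩ := h
  exact ⟨i, fun hxy => hi (by rw [floor_eq, floor_eq, hxy])⟩

/-- If `x'` and `y'` are joined at level `m'`, and `x`, `x'` are separated at levels `m` and `m'`,
then the crossed pair `(x, y')` is separated at both levels. -/
theorem Separated.cross {x' y' : Fin d → ℝ} {m m' : ℤ}
    (hxy' : ¬ Separated d σ m' x' y')
    (h : Separated d σ m x' x) (h' : Separated d σ m' x x') :
    Separated d σ m x y' ∧ Separated d σ m' x y' := by
  have hm' : Separated d σ m' x y' := h'.trans_not_separated hxy'
  refine ⟨?_, hm'⟩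
  rcases le_total m m' with hle | hle
  · exact hm'.mono hle
  · exact (h.symm).trans_not_separated fun hs => hxy' (hs.mono hle)

theorem summable_quadDist (M : ℤ) : Summable fun ℓ : ℤ =>
    if ℓ ≤ M ∧ Separated d σ ℓ x y then (2 : ℝ) ^ ℓ else 0 := by
  refine Summable.of_nat_of_neg ?_ ?_
  · refine summable_of_ne_finset_zero (s := Finset.range (M.toNat + 1)) fun n hn => ?_
    rw [Finset.mem_range] at hn
    exact if_neg fun h => by omega
  · refine Summable.of_nonneg_of_le (fun n => ?_) (fun n => ?_) summable_geometric_two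
    · positivity
    · split_ifs
      · simp
      · positivity

theorem quadDist_lt_quadDist {M m : ℤ} {x' y' : Fin d → ℝ} (hm : m ≤ M)
    (hxy : ¬ Separated d σ m x y) (hxy' : Separated d σ m x' y') :
    quadDist d M σ x y < quadDist d M σ x' y' := by
  unfold quadDist
  refine mul_lt_mul_of_pos_left ?_ two_pos
  refine Summable.tsum_lt_tsum (i := m) (fun ℓ => ?_) ?_
    (summable_quadDist M) (summable_quadDist M)
  · by_cases h : ℓ ≤ M ∧ Separated d σ ℓ x y
    · have hlt : ℓ < m := lt_of_not_ge fun hle => hxy (h.2.mono hle)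
      rw [if_pos h, if_pos ⟨h.1, hxy'.mono hlt.le⟩]
    · rw [if_neg h]
      positivity
  · rw [if_neg fun h => hxy h.2, if_pos ⟨hm, hxy'⟩]
    positivity

end Separation

theorem mul_half_add_diag_le {ι : Type*} {p C : ι → ι → ℝ}
    (hp : ∀ j k, 0 ≤ p j k)
    (hC : ∀ j k, j ≠ k → (C j j + C k k) / 2 < C j k) (j k : ι) :
    p j k * ((C j j + C k k) / 2) ≤ p j k * C j k := by
  refine mul_le_mul_of_nonneg_left ?_ (hp j k)
  rcases eq_or_ne j k with rfl | h
  · simp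
  · exact (hC j k h).le

section FiniteSums

variable {α ι : Type*} [Fintype ι] {X : Finset α} {e e' : ι → α}

theorem sum_eq_sum_comp_of_support_subset_range (he : Function.Injective e) (heX : ∀ k, e k ∈ X)
    {g : α → ℝ} (hg : ∀ a, g a ≠ 0 → ∃ k, e k = a) :
    ∑ a ∈ X, g a = ∑ k, g (e k) := by
  refine (Finset.sum_of_injOn e he.injOn (fun k _ => heX k) (fun a _ ha => ?_)
    fun _ _ => rfl).symm
  by_contra h
  obtain ⟨k, rfl⟩ := hg a h
  exact ha ⟨k, by simp, rfl⟩

theorem sum_sum_eq_sum_sum_comp_of_support_subset_range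
    (he : Function.Injective e) (heX : ∀ k, e k ∈ X)
    (he' : Function.Injective e') (heX' : ∀ k, e' k ∈ X) {g : α → α → ℝ}
    (hg : ∀ a b, g a b ≠ 0 → (∃ k, e k = a) ∧ ∃ k, e' k = b) :
    ∑ a ∈ X, ∑ b ∈ X, g a b = ∑ j, ∑ k, g (e j) (e' k) := by
  rw [sum_eq_sum_comp_of_support_subset_range he heX]
  · exact Finset.sum_congr rfl fun j _ =>
      sum_eq_sum_comp_of_support_subset_range he' heX' fun b hb => (hg _ b hb).2
  · intro a ha
    obtain ⟨b, -, hb⟩ := Finset.exists_ne_zero_of_sum_ne_zero ha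
    exact (hg a b hb).1

theorem IsCouplingOn.left_ne_zero {μ ν : α → ℝ} {τ : α → α → ℝ} (hτ : IsCouplingOn X μ ν τ)
    {a b : α} (h : τ a b ≠ 0) : μ a ≠ 0 := by
  intro ha
  rw [← hτ.2.2.1 a, Finset.sum_eq_zero_iff_of_nonneg fun b _ => hτ.1 a b] at ha
  exact h (ha b (hτ.2.1 a b h).2)

theorem IsCouplingOn.right_ne_zero {μ ν : α → ℝ} {τ : α → α → ℝ} (hτ : IsCouplingOn X μ ν τ)
    {a b : α} (h : τ a b ≠ 0) : ν b ≠ 0 := by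
  intro hb
  rw [← hτ.2.2.2 b, Finset.sum_eq_zero_iff_of_nonneg fun a _ => hτ.1 a b] at hb
  exact h (hb a (hτ.2.1 a b h).1)

/-- Averaging the diagonal costs over both indices gives a feasible dual potential. -/
theorem sum_sum_mul_half_add {p : ι → ι → ℝ} {r : ℝ} (hrow : ∀ j, ∑ k, p j k = r)
    (hcol : ∀ k, ∑ j, p j k = r) (D : ι → ℝ) :
    ∑ j, ∑ k, p j k * ((D j + D k) / 2) = r * ∑ k, D k := by
  have h1 : ∑ j, ∑ k, p j k * D j = r * ∑ k, D k := by
    simp_rw [← Finset.sum_mul, hrow, Finset.mul_sum]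
  have h2 : ∑ j, ∑ k, p j k * D k = r * ∑ k, D k := by
    rw [Finset.sum_comm]
    simp_rw [← Finset.sum_mul, hcol, Finset.mul_sum]
  calc ∑ j, ∑ k, p j k * ((D j + D k) / 2)
      = (∑ j, ∑ k, p j k * D j + ∑ j, ∑ k, p j k * D k) / 2 := by
        simp_rw [← Finset.sum_add_distrib, Finset.sum_div]
        exact Finset.sum_congr rfl fun j _ => Finset.sum_congr rfl fun k _ => by ring
    _ = r * ∑ k, D k := by rw [h1, h2]; ring

variable {p C : ι → ι → ℝ} {r : ℝ}

theorem mul_sum_diag_le_sum_sum_mul (hp : ∀ j k, 0 ≤ p j k) (hrow : ∀ j, ∑ k, p j k = r)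
    (hcol : ∀ k, ∑ j, p j k = r) (hC : ∀ j k, j ≠ k → (C j j + C k k) / 2 < C j k) :
    r * ∑ k, C k k ≤ ∑ j, ∑ k, p j k * C j k := by
  rw [← sum_sum_mul_half_add hrow hcol fun k => C k k]
  exact Finset.sum_le_sum fun j _ => Finset.sum_le_sum fun k _ => mul_half_add_diag_le hp hC j k

theorem eq_zero_of_sum_sum_mul_eq (hp : ∀ j k, 0 ≤ p j k) (hrow : ∀ j, ∑ k, p j k = r)
    (hcol : ∀ k, ∑ j, p j k = r) (hC : ∀ j k, j ≠ k → (C j j + C k k) / 2 < C j k)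
    (h : ∑ j, ∑ k, p j k * C j k = r * ∑ k, C k k) {j k : ι} (hjk : j ≠ k) : p j k = 0 := by
  rw [← sum_sum_mul_half_add hrow hcol fun k => C k k] at h
  have hle := mul_half_add_diag_le hp hC
  have h1 := (Finset.sum_eq_sum_iff_of_le
    fun j _ => Finset.sum_le_sum fun k _ => hle j k).1 h.symm j (Finset.mem_univ j)
  have h2 := (Finset.sum_eq_sum_iff_of_le fun k _ => hle j k).1 h1 k (Finset.mem_univ k)
  by_contra hne
  exact (hC j k hjk).ne (mul_left_cancel₀ hne h2)

end FiniteSums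

/-- Core deterministic lemma for the planted random model: if each pair `(x_k, y_k)` is
joined (not separated) at its least joining level `L_k ≤ M`, and every other `x_j` is
separated from `x_k` at level `L_k`, then the unique coupling of the uniform
distributions `μ` on `{x₁,…,x_s}` and `ν` on `{y₁,…,y_s}` minimizing the quadtree cost
is the perfect matching `f(x_k, y_k) = 1/s`; consequently, for any ground cost `c`, the
Flowtree estimate of the distance between `μ` and `ν` equals `(1/s)·Σ_k c(x_k, y_k)`. -/
theorem stmt16 (d s : ℕ) (hs : 1 ≤ s) (M : ℤ) (σ : Fin d → ℝ)
    (xs ys : Fin s → (Fin d → ℝ))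
    (hxinj : Function.Injective xs) (hyinj : Function.Injective ys)
    (hxy : ∀ j k, xs j ≠ ys k)
    (hjoinM : ∀ k, ¬ Separated d σ M (xs k) (ys k))
    (L : Fin s → ℤ)
    (hL : ∀ k, L k ≤ M ∧ ¬ Separated d σ (L k) (xs k) (ys k) ∧
      ∀ ℓ : ℤ, ℓ ≤ M → ¬ Separated d σ ℓ (xs k) (ys k) → L k ≤ ℓ)
    (hsep : ∀ k j, j ≠ k → Separated d σ (L k) (xs j) (xs k))
    (X : Finset (Fin d → ℝ))
    (hX : X = Finset.image xs Finset.univ ∪ Finset.image ys Finset.univ)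
    (μ ν : (Fin d → ℝ) → ℝ)
    (hμ : μ = fun a => if ∃ k, xs k = a then 1 / (s : ℝ) else 0)
    (hν : ν = fun b => if ∃ k, ys k = b then 1 / (s : ℝ) else 0)
    (f : (Fin d → ℝ) → (Fin d → ℝ) → ℝ)
    (hf : f = fun a b => if ∃ k, xs k = a ∧ ys k = b then 1 / (s : ℝ) else 0) :
    IsCouplingOn X μ ν f ∧
    (∀ τ, IsCouplingOn X μ ν τ →
      (∑ a ∈ X, ∑ b ∈ X, f a b * quadDist d M σ a b) ≤
        ∑ a ∈ X, ∑ b ∈ X, τ a b * quadDist d M σ a b) ∧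
    (∀ τ, IsCouplingOn X μ ν τ →
      (∑ a ∈ X, ∑ b ∈ X, τ a b * quadDist d M σ a b) =
        (∑ a ∈ X, ∑ b ∈ X, f a b * quadDist d M σ a b) → τ = f) ∧
    (∀ c : (Fin d → ℝ) → (Fin d → ℝ) → ℝ,
      (∑ a ∈ X, ∑ b ∈ X, f a b * c a b) = (1 / (s : ℝ)) * ∑ k, c (xs k) (ys k)) := by
  have hxX (k) : xs k ∈ X := by simp [hX]
  have hyX (k) : ys k ∈ X := by simp [hX]
  have hμx (k) : μ (xs k) = 1 / (s : ℝ) := by rw [hμ]; exact if_pos ⟨k, rfl⟩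
  have hνy (k) : ν (ys k) = 1 / (s : ℝ) := by rw [hν]; exact if_pos ⟨k, rfl⟩
  have hμ0 (a) (h : μ a ≠ 0) : ∃ k, xs k = a := by
    by_contra hk
    exact h (by rw [hμ]; exact if_neg hk)
  have hν0 (b) (h : ν b ≠ 0) : ∃ k, ys k = b := by
    by_contra hk
    exact h (by rw [hν]; exact if_neg hk)
  have hf0 (a b) (h : f a b ≠ 0) : ∃ k, xs k = a ∧ ys k = b := by
    by_contra hk
    exact h (by rw [hf]; exact if_neg hk)
  have hfxy (j k) : f (xs j) (ys k) = if j = k then 1 / (s : ℝ) else 0 := by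
    rw [hf]
    refine if_congr ⟨?_, ?_⟩ rfl rfl
    · rintro ⟨i, hi, hi'⟩
      exact (hxinj hi).symm.trans (hyinj hi')
    · rintro rfl
      exact ⟨j, rfl, rfl⟩
  have hfsupp (a b) (h : f a b ≠ 0) : (∃ k, xs k = a) ∧ ∃ k, ys k = b := by
    obtain ⟨k, hk, hk'⟩ := hf0 a b h
    exact ⟨⟨k, hk⟩, k, hk'⟩
  have hfc : IsCouplingOn X μ ν f := by
    refine ⟨fun a b => ?_, fun a b h => ?_, fun a => ?_, fun b => ?_⟩
    · rw [hf]
      positivity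
    · obtain ⟨k, rfl, rfl⟩ := hf0 a b h
      exact ⟨hxX k, hyX k⟩
    · rw [sum_eq_sum_comp_of_support_subset_range hyinj hyX fun b h => (hfsupp a b h).2]
      by_cases ha : ∃ k, xs k = a
      · obtain ⟨k, rfl⟩ := ha
        simp [hfxy, hμx]
      · rw [not_imp_comm.1 (hμ0 a) ha]
        exact Finset.sum_eq_zero fun k _ => not_imp_comm.1 (fun h => (hfsupp a (ys k) h).1) ha
    · rw [sum_eq_sum_comp_of_support_subset_range hxinj hxX fun a h => (hfsupp a b h).1]
      by_cases hb : ∃ k, ys k = b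
      · obtain ⟨k, rfl⟩ := hb
        simp [hfxy, hνy]
      · rw [not_imp_comm.1 (hν0 b) hb]
        exact Finset.sum_eq_zero fun k _ => not_imp_comm.1 (fun h => (hfsupp (xs k) b h).2) hb
  have hsupp {τ} (hτ : IsCouplingOn X μ ν τ) (a b) (h : τ a b ≠ 0) :
      (∃ k, xs k = a) ∧ ∃ k, ys k = b :=
    ⟨hμ0 a (hτ.left_ne_zero h), hν0 b (hτ.right_ne_zero h)⟩
  have hcost {τ} (hτ : IsCouplingOn X μ ν τ) (c : (Fin d → ℝ) → (Fin d → ℝ) → ℝ) :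
      ∑ a ∈ X, ∑ b ∈ X, τ a b * c a b = ∑ j, ∑ k, τ (xs j) (ys k) * c (xs j) (ys k) :=
    sum_sum_eq_sum_sum_comp_of_support_subset_range hxinj hxX hyinj hyX
      fun a b h => hsupp hτ a b (left_ne_zero_of_mul h)
  have hfcost (c : (Fin d → ℝ) → (Fin d → ℝ) → ℝ) :
      ∑ a ∈ X, ∑ b ∈ X, f a b * c a b = (1 / (s : ℝ)) * ∑ k, c (xs k) (ys k) := by
    rw [hcost hfc]
    simp [hfxy, Finset.mul_sum]
  have hrow {τ} (hτ : IsCouplingOn X μ ν τ) (j) : ∑ k, τ (xs j) (ys k) = 1 / (s : ℝ) := by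
    rw [← hμx j, ← hτ.2.2.1]
    exact (sum_eq_sum_comp_of_support_subset_range hyinj hyX fun b h => (hsupp hτ _ b h).2).symm
  have hcol {τ} (hτ : IsCouplingOn X μ ν τ) (k) : ∑ j, τ (xs j) (ys k) = 1 / (s : ℝ) := by
    rw [← hνy k, ← hτ.2.2.2]
    exact (sum_eq_sum_comp_of_support_subset_range hxinj hxX fun a h => (hsupp hτ a _ h).1).symm
  have hC (j k) (hjk : j ≠ k) :
      (quadDist d M σ (xs j) (ys j) + quadDist d M σ (xs k) (ys k)) / 2 <
        quadDist d M σ (xs j) (ys k) := by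
    obtain ⟨hj, hk⟩ := Separated.cross (hL k).2.1 (hsep j k hjk.symm) (hsep k j hjk)
    have hltj := quadDist_lt_quadDist (hL j).1 (hL j).2.1 hj
    have hltk := quadDist_lt_quadDist (hL k).1 (hL k).2.1 hk
    linarith
  refine ⟨hfc, fun τ hτ => ?_, fun τ hτ h => ?_, hfcost⟩
  · rw [hfcost, hcost hτ]
    exact mul_sum_diag_le_sum_sum_mul (C := fun j k => quadDist d M σ (xs j) (ys k))
      (fun j k => hτ.1 _ _) (hrow hτ) (hcol hτ) hC
  · rw [hfcost, hcost hτ] at h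
    have hzero (j k) (hjk : j ≠ k) : τ (xs j) (ys k) = 0 :=
      eq_zero_of_sum_sum_mul_eq (p := fun j k => τ (xs j) (ys k))
        (C := fun j k => quadDist d M σ (xs j) (ys k))
        (fun j k => hτ.1 _ _) (hrow hτ) (hcol hτ) hC h hjk
    have hτxy (j k) : τ (xs j) (ys k) = f (xs j) (ys k) := by
      rw [hfxy]
      split_ifs with hjk
      · subst hjk
        rw [← hrow hτ j]
        exact (Fintype.sum_eq_single j fun k hk => hzero j k hk.symm).symm
      · exact hzero j k hjk
    ext a b
    by_cases hab : (∃ k, xs k = a) ∧ ∃ k, ys k = b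
    · obtain ⟨⟨j, rfl⟩, k, rfl⟩ := hab
      exact hτxy j k
    · rw [not_imp_comm.1 (hsupp hτ a b) hab, not_imp_comm.1 (hfsupp a b) hab]
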